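/- Let U ⊆ ℝ² be open, let F : U → ℝ be three times continuously differentiable, and let β ∈ ℝ. Then at every point of U where ∇F ≠ 0, the derivative of the function G := H(F) + β(F_x² + F_y²)^{3/2} along the vector field v = (F_y, −F_x) satisfies: F_y ∂_x G − F_x ∂_y G = (F_xxx F_y³ − 3 F_xxy F_x F_y² + 3 F_xyy F_x² F_y − F_yyy F_x³) + 3β (F_x² + F_y²)^{1/2} (F_xx F_x F_y + F_xy (F_y² − F_x²) − F_yy F_x F_y). -/

import Mathlib

open Real

/-- Partial derivative in the first variable. -/
noncomputable def pdx (F : ℝ × ℝ → ℝ) (p : ℝ × ℝ) : ℝ :=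
  deriv (fun t => F (t, p.2)) p.1

/-- Partial derivative in the second variable. -/
noncomputable def pdy (F : ℝ × ℝ → ℝ) (p : ℝ × ℝ) : ℝ :=
  deriv (fun t => F (p.1, t)) p.2

/-- `H(F) = F_xx F_y² − 2 F_xy F_x F_y + F_yy F_x²`. -/
noncomputable def Hf (F : ℝ × ℝ → ℝ) (p : ℝ × ℝ) : ℝ :=
  pdx (pdx F) p * (pdy F p) ^ 2 - 2 * pdy (pdx F) p * pdx F p * pdy F p
    + pdy (pdy F) p * (pdx F p) ^ 2

lemma hdx {f : ℝ × ℝ → ℝ} {p : ℝ × ℝ} (h : DifferentiableAt ℝ f p) :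
    HasDerivAt (fun t => f (t, p.2)) (fderiv ℝ f p (1, 0)) p.1 := by
  have h1 : HasDerivAt (fun t : ℝ => (t, p.2)) ((1 : ℝ), (0 : ℝ)) p.1 :=
    (hasDerivAt_id p.1).prodMk (hasDerivAt_const p.1 p.2)
  exact HasFDerivAt.comp_hasDerivAt (l := f) p.1 h.hasFDerivAt h1

lemma hdy {f : ℝ × ℝ → ℝ} {p : ℝ × ℝ} (h : DifferentiableAt ℝ f p) :
    HasDerivAt (fun t => f (p.1, t)) (fderiv ℝ f p (0, 1)) p.2 := by
  have h1 : HasDerivAt (fun t : ℝ => (p.1, t)) ((0 : ℝ), (1 : ℝ)) p.2 :=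
    (hasDerivAt_const p.2 p.1).prodMk (hasDerivAt_id p.2)
  exact HasFDerivAt.comp_hasDerivAt (l := f) p.2 h.hasFDerivAt h1

lemma pdx_eq {f : ℝ × ℝ → ℝ} {p : ℝ × ℝ} (h : DifferentiableAt ℝ f p) :
    pdx f p = fderiv ℝ f p (1, 0) := (hdx h).deriv

lemma pdy_eq {f : ℝ × ℝ → ℝ} {p : ℝ × ℝ} (h : DifferentiableAt ℝ f p) :
    pdy f p = fderiv ℝ f p (0, 1) := (hdy h).deriv

lemma hpx {f : ℝ × ℝ → ℝ} {p : ℝ × ℝ} (h : DifferentiableAt ℝ f p) :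
    HasDerivAt (fun t => f (t, p.2)) (pdx f p) p.1 := by
  rw [pdx_eq h]; exact hdx h

lemma hpy {f : ℝ × ℝ → ℝ} {p : ℝ × ℝ} (h : DifferentiableAt ℝ f p) :
    HasDerivAt (fun t => f (p.1, t)) (pdy f p) p.2 := by
  rw [pdy_eq h]; exact hdy h

lemma diffAt_of {U : Set (ℝ × ℝ)} (hU : IsOpen U) {f : ℝ × ℝ → ℝ} {n : WithTop ℕ∞}
    (hn : n ≠ 0) (hf : ContDiffOn ℝ n f U) {p : ℝ × ℝ} (hp : p ∈ U) : DifferentiableAt ℝ f p :=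
  (hf.contDiffAt (hU.mem_nhds hp)).differentiableAt hn

lemma cd_pdx {U : Set (ℝ × ℝ)} (hU : IsOpen U) {f : ℝ × ℝ → ℝ} {n m : WithTop ℕ∞}
    (hn : n ≠ 0) (hm : m + 1 ≤ n) (hf : ContDiffOn ℝ n f U) : ContDiffOn ℝ m (pdx f) U := by
  have h : ContDiffOn ℝ m (fun q => fderiv ℝ f q (1, 0)) U :=
    (hf.fderiv_of_isOpen hU hm).clm_apply contDiffOn_const
  exact h.congr fun q hq => pdx_eq (diffAt_of hU hn hf hq)

lemma cd_pdy {U : Set (ℝ × ℝ)} (hU : IsOpen U) {f : ℝ × ℝ → ℝ} {n m : WithTop ℕ∞}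
    (hn : n ≠ 0) (hm : m + 1 ≤ n) (hf : ContDiffOn ℝ n f U) : ContDiffOn ℝ m (pdy f) U := by
  have h : ContDiffOn ℝ m (fun q => fderiv ℝ f q (0, 1)) U :=
    (hf.fderiv_of_isOpen hU hm).clm_apply contDiffOn_const
  exact h.congr fun q hq => pdy_eq (diffAt_of hU hn hf hq)

lemma pd_symm {U : Set (ℝ × ℝ)} (hU : IsOpen U) {f : ℝ × ℝ → ℝ}
    (hf : ContDiffOn ℝ 2 f U) {p : ℝ × ℝ} (hp : p ∈ U) : pdx (pdy f) p = pdy (pdx f) p := by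
  have h2 : (2 : WithTop ℕ∞) ≠ 0 := by norm_num
  have h12 : (1 : WithTop ℕ∞) + 1 ≤ 2 := by norm_num
  have hx := cd_pdx hU h2 h12 hf
  have hy := cd_pdy hU h2 h12 hf
  rw [pdx_eq (diffAt_of hU one_ne_zero hy hp), pdy_eq (diffAt_of hU one_ne_zero hx hp)]
  have ex : pdx f =ᶠ[nhds p] fun q => fderiv ℝ f q (1, 0) := by
    filter_upwards [hU.mem_nhds hp] with q hq using pdx_eq (diffAt_of hU h2 hf hq)
  have ey : pdy f =ᶠ[nhds p] fun q => fderiv ℝ f q (0, 1) := by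
    filter_upwards [hU.mem_nhds hp] with q hq using pdy_eq (diffAt_of hU h2 hf hq)
  rw [ex.fderiv_eq, ey.fderiv_eq]
  have hd : DifferentiableAt ℝ (fderiv ℝ f) p :=
    ((hf.fderiv_of_isOpen hU h12).contDiffAt (hU.mem_nhds hp)).differentiableAt one_ne_zero
  rw [fderiv_clm_apply hd (differentiableAt_const _), fderiv_clm_apply hd (differentiableAt_const _)]
  have hs : IsSymmSndFDerivAt ℝ f p :=
    (hf.contDiffAt (hU.mem_nhds hp)).isSymmSndFDerivAt (by simp)
  simpa using hs.eq (1, 0) (0, 1)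

lemma pdy_congr {U : Set (ℝ × ℝ)} (hU : IsOpen U) {f g : ℝ × ℝ → ℝ}
    (h : ∀ q ∈ U, f q = g q) {p : ℝ × ℝ} (hp : p ∈ U) : pdy f p = pdy g p := by
  have hc : ContinuousAt (fun t : ℝ => (p.1, t)) p.2 := by fun_prop
  have he : (fun t : ℝ => f (p.1, t)) =ᶠ[nhds p.2] fun t => g (p.1, t) := by
    filter_upwards [hc.preimage_mem_nhds (hU.mem_nhds hp)] with t ht using h _ ht
  exact he.deriv_eq

lemma hasDeriv_G {a b c u v : ℝ → ℝ} {a' b' c' u' v' t β : ℝ}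
    (ha : HasDerivAt a a' t) (hb : HasDerivAt b b' t) (hc : HasDerivAt c c' t)
    (hu : HasDerivAt u u' t) (hv : HasDerivAt v v' t) (h0 : u t ^ 2 + v t ^ 2 ≠ 0) :
    HasDerivAt (fun s => a s * v s ^ 2 - 2 * b s * u s * v s + c s * u s ^ 2
        + β * (u s ^ 2 + v s ^ 2) ^ ((3 : ℝ) / 2))
      (a' * v t ^ 2 + 2 * a t * v t * v' - 2 * (b' * u t * v t + b t * u' * v t + b t * u t * v')
        + c' * u t ^ 2 + 2 * c t * u t * u'
        + 3 * β * (u t ^ 2 + v t ^ 2) ^ ((1 : ℝ) / 2) * (u t * u' + v t * v')) t := by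
  have hr := (((hu.pow 2).add (hv.pow 2)).rpow_const (p := (3 : ℝ) / 2) (Or.inl h0)).const_mul β
  have hH := ((ha.mul (hv.pow 2)).sub (((hb.const_mul 2).mul hu).mul hv)).add (hc.mul (hu.pow 2))
  refine (hH.add hr).congr_deriv ?_
  have e : (3 : ℝ) / 2 - 1 = 1 / 2 := by norm_num
  rw [e]
  simp only [Pi.add_apply, Pi.pow_apply, Pi.mul_apply]
  push_cast
  ring

/-- For a C³ function F, at every non-critical point the derivative of
`G = H(F) + β(F_x² + F_y²)^{3/2}` along the vector field `(F_y, −F_x)` equals the cubic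
coefficient of the invariance equation of the magnetic billiard map. -/
theorem derivative_along_level_curves
    (U : Set (ℝ × ℝ)) (hU : IsOpen U) (F : ℝ × ℝ → ℝ)
    (hF : ContDiffOn ℝ 3 F U) (β : ℝ)
    (G : ℝ × ℝ → ℝ)
    (hG : ∀ q, G q = Hf F q + β * (pdx F q ^ 2 + pdy F q ^ 2) ^ ((3 : ℝ) / 2)) :
    ∀ p ∈ U, (pdx F p, pdy F p) ≠ (0, 0) →
      pdy F p * pdx G p - pdx F p * pdy G p =
        (pdx (pdx (pdx F)) p * (pdy F p) ^ 3
          - 3 * pdy (pdx (pdx F)) p * pdx F p * (pdy F p) ^ 2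
          + 3 * pdy (pdy (pdx F)) p * (pdx F p) ^ 2 * pdy F p
          - pdy (pdy (pdy F)) p * (pdx F p) ^ 3)
        + 3 * β * (pdx F p ^ 2 + pdy F p ^ 2) ^ ((1 : ℝ) / 2) *
          (pdx (pdx F) p * pdx F p * pdy F p
            + pdy (pdx F) p * ((pdy F p) ^ 2 - (pdx F p) ^ 2)
            - pdy (pdy F) p * pdx F p * pdy F p) := by
  intro p hp hne
  have h3 : (3 : WithTop ℕ∞) ≠ 0 := by norm_num
  have h2 : (2 : WithTop ℕ∞) ≠ 0 := by norm_num
  have h12 : (1 : WithTop ℕ∞) + 1 ≤ 2 := by norm_num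
  have h23 : (2 : WithTop ℕ∞) + 1 ≤ 3 := by norm_num
  have hF2 : ContDiffOn ℝ 2 F U := hF.of_le (by norm_num)
  have cx := cd_pdx hU h3 h23 hF
  have cy := cd_pdy hU h3 h23 hF
  have dx := diffAt_of hU h2 cx hp
  have dy := diffAt_of hU h2 cy hp
  have dxx := diffAt_of hU one_ne_zero (cd_pdx hU h2 h12 cx) hp
  have dxy := diffAt_of hU one_ne_zero (cd_pdy hU h2 h12 cx) hp
  have dyy := diffAt_of hU one_ne_zero (cd_pdy hU h2 h12 cy) hp
  have s1 := pd_symm hU hF2 hp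
  have s2 := pd_symm hU cx hp
  have s3 : pdx (pdy (pdy F)) p = pdy (pdy (pdx F)) p := by
    rw [pd_symm hU cy hp]
    exact pdy_congr hU (fun q hq => pd_symm hU hF2 hq) hp
  have h0 : pdx F p ^ 2 + pdy F p ^ 2 ≠ 0 := by
    intro h
    apply hne
    have a1 : pdx F p = 0 := by nlinarith [sq_nonneg (pdx F p), sq_nonneg (pdy F p)]
    have a2 : pdy F p = 0 := by nlinarith [sq_nonneg (pdx F p), sq_nonneg (pdy F p)]
    rw [a1, a2]
  have hGe : G = fun q => Hf F q + β * (pdx F q ^ 2 + pdy F q ^ 2) ^ ((3 : ℝ) / 2) := funext hG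
  have gx := (hasDeriv_G (β := β) (hpx dxx) (hpx dxy) (hpx dyy) (hpx dx) (hpx dy) h0).deriv
  have gy := (hasDeriv_G (β := β) (hpy dxx) (hpy dxy) (hpy dyy) (hpy dx) (hpy dy) h0).deriv
  have ex := (show pdx G p = deriv _ _ by rw [hGe]; rfl).trans gx
  have ey := (show pdy G p = deriv _ _ by rw [hGe]; rfl).trans gy
  rw [ex, ey]
  simp only [Prod.mk.eta, s1, s2, s3]
  ring
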